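/- arXiv:1101.5867 — 3 statements merged into one kernel-verified Lean document; each statement's English description precedes it below -/
import Mathlib

section
/- For every integer j, the cross products of consecutive basis vectors satisfy s_{−j} × s_{−j+1} = s*_j, and jumping by one index, s_{−j−1} × s_{−j+1} = −s*_{j−1} + 3·s*_j. -/
open Matrix

def S : Matrix (Fin 3) (Fin 3) ℤ := !![0, 0, 1; 1, 0, -3; 0, 1, -3]

theorem transpose_S_mulVec_crossProduct (a b : Fin 3 → ℤ) :
    Sᵀ.mulVec (crossProduct (S.mulVec a) (S.mulVec b)) = crossProduct a b := by
  ext i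
  fin_cases i <;>
    simp [S, cross_apply, Matrix.mulVec, dotProduct, Fin.sum_univ_three] <;> ring

theorem transpose_S_mulVec_injective : Function.Injective Sᵀ.mulVec := by
  apply Matrix.mulVec_injective_of_isUnit
  rw [Matrix.isUnit_iff_isUnit_det]
  simp [S, Matrix.det_fin_three]

theorem S_mulVec_recurrence (a : Fin 3 → ℤ) :
    a = S.mulVec (S.mulVec (S.mulVec a)) + (3 : ℤ) • S.mulVec a
      + (3 : ℤ) • S.mulVec (S.mulVec a) := by
  ext i
  fin_cases i <;>
    simp [S, dotProduct, Fin.sum_univ_three] <;> ring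

theorem cross_products_of_basis_vectors
    (s : ℤ → (Fin 3 → ℤ))
    (hs0 : s 0 = ![0, 1, 0])
    (hs : ∀ j : ℤ, s (j + 1) = S.mulVec (s j))
    (sstar : ℤ → (Fin 3 → ℤ))
    (hsstar0 : sstar 0 = ![1, 0, 0])
    (hsstar : ∀ j : ℤ, sstar (j + 1) = Sᵀ.mulVec (sstar j)) :
    ∀ j : ℤ,
      crossProduct (s (-j)) (s (-j + 1)) = sstar j ∧
      crossProduct (s (-j - 1)) (s (-j + 1)) = -sstar (j - 1) + (3 : ℤ) • sstar j := by
  have hstep (k : ℤ) : Sᵀ.mulVec (crossProduct (s (k + 1)) (s (k + 1 + 1)))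
      = crossProduct (s k) (s (k + 1)) := by
    rw [hs (k + 1), hs k, transpose_S_mulVec_crossProduct]
  have hcross (j : ℤ) : crossProduct (s (-j)) (s (-j + 1)) = sstar j := by
    induction j using Int.induction_on with
    | zero =>
      rw [neg_zero, hs, hs0, hsstar0]
      ext i
      fin_cases i <;> simp [S, cross_apply]
    | succ n ih =>
      have h := hstep (-((n : ℤ) + 1))
      rw [show -((n : ℤ) + 1) + 1 = -n by ring] at h ⊢
      rw [hsstar, ← h, ih]
    | pred n ih =>
      apply transpose_S_mulVec_injective
      have h := hstep (- -(n : ℤ))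
      rw [show -(-(n : ℤ) - 1) = - -(n : ℤ) + 1 by ring, h, ih, ← hsstar, sub_add_cancel]
  intro j
  refine ⟨hcross j, ?_⟩
  have hb : s (-j) = S.mulVec (s (-j - 1)) := by rw [← hs, sub_add_cancel]
  have hrec := S_mulVec_recurrence (s (-j - 1))
  rw [← hb, ← hs, ← hs] at hrec
  have hprev := hcross (j - 1)
  rw [show -(j - 1) = -j + 1 by ring] at hprev
  rw [hrec, ← hcross j, ← hprev, ← cross_anticomm (s (-j + 1 + 1)), neg_neg]
  simp only [map_add, map_smul, LinearMap.add_apply, LinearMap.smul_apply, cross_self,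
    smul_zero, add_zero]
end

section
/- For every integer j, s*_j = T·s_j, where T is the 3×3 integer matrix with rows (3,1,0), (1,0,0), (0,0,1). -/
open Matrix

def T : Matrix (Fin 3) (Fin 3) ℤ := !![3, 1, 0; 1, 0, 0; 0, 0, 1]

theorem T_mul_S : T * S = Sᵀ * T := by
  decide

theorem mulVec_transpose_S_injective : Function.Injective (Sᵀ).mulVec := by
  refine Matrix.mulVec_injective_of_isUnit ((Matrix.isUnit_iff_isUnit_det _).2 ?_)
  simp [S, Matrix.det_fin_three]

theorem sstar_eq_T_mul_s
    (s : ℤ → (Fin 3 → ℤ))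
    (hs0 : s 0 = ![0, 1, 0])
    (hs : ∀ j : ℤ, s (j + 1) = S.mulVec (s j))
    (sstar : ℤ → (Fin 3 → ℤ))
    (hsstar0 : sstar 0 = ![1, 0, 0])
    (hsstar : ∀ j : ℤ, sstar (j + 1) = Sᵀ.mulVec (sstar j)) :
    ∀ j : ℤ, sstar j = T.mulVec (s j) := by
  have hT (j : ℤ) : T.mulVec (s (j + 1)) = Sᵀ.mulVec (T.mulVec (s j)) := by
    rw [hs, mulVec_mulVec, mulVec_mulVec, T_mul_S]
  intro j
  induction j using Int.induction_on with
  | zero =>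
    rw [hs0, hsstar0]
    decide
  | succ i ih => rw [hsstar, hT, ih]
  | pred i ih =>
    apply mulVec_transpose_S_injective
    rw [← hsstar, ← hT, sub_add_cancel, ih]
end

section
/- Let j ≥ 1 be an integer and let a = (a₁, a₂, a₃) ∈ ℤ³ be a nonzero vector such that ⟨a, s*_j⟩ = 0 and the Euclidean norm satisfies ‖a‖ < (1/3)·ρ^(j/4). Then a₁·s_{j−1} + a₂·s_j + a₃·s_{j+1} = (0, p, −q) for some integers p, q with q ≠ 0, and |p − q·σ| < 1/(2·|q|); consequently p/q is a convergent of the regular continued fraction expansion of σ. -/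
open Matrix

noncomputable def cbrt2 : ℝ := (2 : ℝ) ^ ((1 : ℝ) / 3)
noncomputable def cbrt4 : ℝ := (2 : ℝ) ^ ((2 : ℝ) / 3)
noncomputable def σ : ℝ := cbrt2 - 1
noncomputable def ρ : ℝ := 1 + cbrt2 + cbrt4

lemma cbrt2_pow_three : cbrt2 ^ 3 = 2 := by
  rw [cbrt2, ← Real.rpow_natCast, ← Real.rpow_mul (by norm_num)]
  norm_num

lemma cbrt2_pos : 0 < cbrt2 := by
  unfold cbrt2; positivity

lemma cbrt4_eq : cbrt4 = cbrt2 ^ 2 := by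
  rw [cbrt4, cbrt2, ← Real.rpow_natCast, ← Real.rpow_mul (by norm_num)]
  norm_num

lemma σ_cubic : σ ^ 3 = 1 - 3 * σ - 3 * σ ^ 2 := by
  have h := cbrt2_pow_three
  unfold σ
  linear_combination h

lemma ρ_eq : ρ = σ ^ 2 + 3 * σ + 3 := by
  rw [ρ, cbrt4_eq, σ]
  ring

lemma σ_mul_ρ : σ * ρ = 1 := by
  rw [ρ_eq]
  linear_combination σ_cubic

lemma σ_gt : 0.2599 < σ := by
  have h := cbrt2_pow_three
  have h0 := cbrt2_pos
  unfold σ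
  by_contra! hc
  have : cbrt2 ^ 3 ≤ 1.2599 ^ 3 := pow_le_pow_left₀ h0.le (by linarith) 3
  norm_num at this
  linarith

lemma σ_lt : σ < 0.26 := by
  have h := cbrt2_pow_three
  unfold σ
  by_contra! hc
  have : (1.26 : ℝ) ^ 3 ≤ cbrt2 ^ 3 := pow_le_pow_left₀ (by norm_num) (by linarith) 3
  norm_num at this
  linarith

lemma ρ_pos : 0 < ρ := by
  rw [ρ_eq]
  have := σ_gt
  positivity

lemma ρ_lt : ρ < 3.8476 := by
  rw [ρ_eq]
  nlinarith [σ_gt, σ_lt]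

/-- The element of `ℤ[σ]` with coordinates `v` in the basis `1, σ, σ ^ 2`. -/
noncomputable def realEmb (v : Fin 3 → ℤ) : ℝ := v 0 + v 1 * σ + v 2 * σ ^ 2

/-- The squared absolute value of the image of `v 0 + v 1 * σ + v 2 * σ ^ 2` under the complex
embeddings; the image of `σ` has squared absolute value `ρ` and real part `-(3 + σ) / 2`. -/
noncomputable def complexNormSq (v : Fin 3 → ℤ) : ℝ :=
  v 0 ^ 2 + v 1 ^ 2 * ρ + v 2 ^ 2 * ρ ^ 2 - v 0 * v 1 * (3 + σ)
    + v 0 * v 2 * ((3 + σ) ^ 2 - 2 * ρ) - v 1 * v 2 * ρ * (3 + σ)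

lemma S_mulVec (v : Fin 3 → ℤ) : S *ᵥ v = ![v 2, v 0 - 3 * v 2, v 1 - 3 * v 2] := by
  ext i
  fin_cases i <;> simp [S, Matrix.mulVec, dotProduct, Fin.sum_univ_three] <;> ring

lemma realEmb_S_mulVec (v : Fin 3 → ℤ) : realEmb (S *ᵥ v) = σ * realEmb v := by
  simp only [S_mulVec, realEmb]
  simp
  linear_combination (-(v 2 : ℝ)) * σ_cubic

lemma complexNormSq_S_mulVec (v : Fin 3 → ℤ) :
    complexNormSq (S *ᵥ v) = ρ * complexNormSq v := by
  simp only [S_mulVec, complexNormSq]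
  simp
  have h4 : σ ^ 4 = σ * (1 - 3 * σ - 3 * σ ^ 2) := by rw [← σ_cubic]; ring
  have h5 : σ ^ 5 = σ ^ 2 * (1 - 3 * σ - 3 * σ ^ 2) := by rw [← σ_cubic]; ring
  have h6 : σ ^ 6 = σ ^ 3 * (1 - 3 * σ - 3 * σ ^ 2) := by rw [← σ_cubic]; ring
  rw [ρ_eq]
  ring_nf
  simp only [h6, h5, h4, σ_cubic]
  ring_nf
  simp only [h4, σ_cubic]
  ring_nf
  simp only [σ_cubic]
  ring

lemma realEmb_pow_mulVec (n : ℕ) (v : Fin 3 → ℤ) :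
    realEmb (S ^ n *ᵥ v) = σ ^ n * realEmb v := by
  induction n with
  | zero => simp
  | succ n ih => rw [pow_succ', ← mulVec_mulVec, realEmb_S_mulVec, ih]; ring

lemma complexNormSq_pow_mulVec (n : ℕ) (v : Fin 3 → ℤ) :
    complexNormSq (S ^ n *ᵥ v) = ρ ^ n * complexNormSq v := by
  induction n with
  | zero => simp
  | succ n ih => rw [pow_succ', ← mulVec_mulVec, complexNormSq_S_mulVec, ih]; ring

lemma S_pow_mulVec_ne_zero (n : ℕ) {v : Fin 3 → ℤ} (hv : v ≠ 0) : S ^ n *ᵥ v ≠ 0 := by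
  have hdet : S.det = 1 := by simp [S, det_fin_three]
  intro h
  apply hv
  refine eq_zero_of_mulVec_eq_zero (M := S ^ n) ?_ h
  simp [det_pow, hdet]

lemma realEmb_sq_le (v : Fin 3 → ℤ) :
    realEmb v ^ 2 ≤ ((v 0 : ℝ) ^ 2 + v 1 ^ 2 + v 2 ^ 2) * (1 + σ ^ 2 + σ ^ 4) := by
  unfold realEmb
  nlinarith [sq_nonneg ((v 0 : ℝ) * σ - v 1), sq_nonneg ((v 0 : ℝ) * σ ^ 2 - v 2),
    sq_nonneg ((v 1 : ℝ) * σ ^ 2 - v 2 * σ)]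

lemma complexNormSq_le (v : Fin 3 → ℤ) :
    complexNormSq v ≤ ((v 0 : ℝ) ^ 2 + v 1 ^ 2 + v 2 ^ 2) * (1 + ρ + ρ ^ 2) := by
  have hσ : 0 ≤ 4 * ρ - (3 + σ) ^ 2 := by
    rw [ρ_eq]
    nlinarith [σ_gt]
  set d := 4 * ρ - (3 + σ) ^ 2 with hd
  unfold complexNormSq
  -- Lagrange's identity for the complex vectors `v` and `(1, x, x ^ 2)`, `x` a conjugate of `σ`
  set r := -(3 + σ) / 2 with hr
  have hρ : ρ = r ^ 2 + d / 4 := by rw [hd, hr]; ring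
  have hs : 3 + σ = -2 * r := by rw [hr]; ring
  rw [hs, hρ]
  set x := (v 0 : ℝ)
  set y := (v 1 : ℝ)
  set z := (v 2 : ℝ)
  have key : (x ^ 2 + y ^ 2 + z ^ 2) * (1 + (r ^ 2 + d / 4) + (r ^ 2 + d / 4) ^ 2)
      - (x ^ 2 + y ^ 2 * (r ^ 2 + d / 4) + z ^ 2 * (r ^ 2 + d / 4) ^ 2 - x * y * (-2 * r)
        + x * z * ((-2 * r) ^ 2 - 2 * (r ^ 2 + d / 4)) - y * z * (r ^ 2 + d / 4) * (-2 * r))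
      = (x * r - y) ^ 2 + x ^ 2 * (d / 4) + (x * (r ^ 2 - d / 4) - z) ^ 2 + d * x ^ 2 * r ^ 2
        + (r ^ 2 + d / 4) * ((y * r - z) ^ 2 + y ^ 2 * (d / 4)) := by
    ring
  have : 0 ≤ (x * r - y) ^ 2 + x ^ 2 * (d / 4) + (x * (r ^ 2 - d / 4) - z) ^ 2 + d * x ^ 2 * r ^ 2
        + (r ^ 2 + d / 4) * ((y * r - z) ^ 2 + y ^ 2 * (d / 4)) := by
    positivity
  linarith

lemma one_le_sq_add_sq_add_sq {a : Fin 3 → ℤ} (ha : a ≠ 0) :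
    (1 : ℝ) ≤ (a 0 : ℝ) ^ 2 + a 1 ^ 2 + a 2 ^ 2 := by
  have : 0 < a 0 ^ 2 + a 1 ^ 2 + a 2 ^ 2 := by
    obtain ⟨i, hi⟩ := Function.ne_iff.mp ha
    have hi' : 0 < a i ^ 2 := by
      have : a i ≠ 0 := hi
      positivity
    fin_cases i <;> simp at hi' <;> nlinarith [sq_nonneg (a 0), sq_nonneg (a 1), sq_nonneg (a 2)]
  exact_mod_cast this

/-- A vector satisfying the size hypothesis is mapped by `S ^ m` to one that is small under the real
embedding and whose two embeddings have a small product. -/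
lemma embedding_bounds {m : ℕ} {a : Fin 3 → ℤ} (ha : a ≠ 0)
    (hshort : Real.sqrt ((a 0 : ℝ) ^ 2 + (a 1 : ℝ) ^ 2 + (a 2 : ℝ) ^ 2)
      < (1 / 3) * ρ ^ ((m : ℝ) / 4)) :
    realEmb (S ^ m *ᵥ a) ^ 2 < 0.0002 ∧
      realEmb (S ^ m *ᵥ a) ^ 2 * complexNormSq (S ^ m *ᵥ a) ≤ 0.261 := by
  rw [realEmb_pow_mulVec, complexNormSq_pow_mulVec]
  have hA := one_le_sq_add_sq_add_sq ha
  have hL := realEmb_sq_le a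
  have hQ := complexNormSq_le a
  set A := (a 0 : ℝ) ^ 2 + a 1 ^ 2 + a 2 ^ 2
  set T := σ ^ m with hT
  have hσ := σ_gt
  have hσ' := σ_lt
  have hT0 : 0 < T := by positivity
  have hTρ : T * ρ ^ m = 1 := by rw [hT, ← mul_pow, σ_mul_ρ, one_pow]
  have hTA : T * A ^ 2 < 1 / 81 := by
    have h4 : Real.sqrt A ^ 4 < ((1 / 3) * ρ ^ ((m : ℝ) / 4)) ^ 4 :=
      pow_lt_pow_left₀ hshort (Real.sqrt_nonneg _) (by norm_num)
    have e1 : Real.sqrt A ^ 4 = A ^ 2 := by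
      rw [show 4 = 2 * 2 from rfl, pow_mul, Real.sq_sqrt (by linarith)]
    have e2 : (ρ ^ ((m : ℝ) / 4)) ^ 4 = ρ ^ m := by
      rw [← Real.rpow_natCast, ← Real.rpow_mul ρ_pos.le, ← Real.rpow_natCast ρ m]
      congr 1
      push_cast
      ring
    rw [e1, mul_pow, e2] at h4
    calc T * A ^ 2 < T * ((1 / 3) ^ 4 * ρ ^ m) := by gcongr
      _ = (1 / 3) ^ 4 * (T * ρ ^ m) := by ring
      _ = 1 / 81 := by rw [hTρ]; norm_num
  have hk1 : 1 + σ ^ 2 + σ ^ 4 ≤ 1.0722 := by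
    have h2 : σ ^ 2 ≤ 0.26 ^ 2 := by gcongr
    have h4 : σ ^ 4 ≤ 0.26 ^ 4 := by gcongr
    norm_num at h2 h4 ⊢
    linarith
  have hk2 : 1 + ρ + ρ ^ 2 ≤ 19.66 := by
    nlinarith [ρ_lt, ρ_pos]
  have hL' : realEmb a ^ 2 ≤ A * 1.0722 := hL.trans (by gcongr)
  have hQ' : complexNormSq a ≤ A * 19.66 := hQ.trans (by gcongr)
  constructor
  · have h1 : T * A ≤ T * A ^ 2 := by
      apply mul_le_mul_of_nonneg_left _ hT0.le
      nlinarith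
    have h2 : T ≤ T * A := le_mul_of_one_le_right hT0.le hA
    calc (T * realEmb a) ^ 2 = T ^ 2 * realEmb a ^ 2 := by ring
      _ ≤ T ^ 2 * (A * 1.0722) := by gcongr
      _ = T * (T * A) * 1.0722 := by ring
      _ ≤ (1 / 81) * (1 / 81) * 1.0722 := by
        gcongr <;> linarith
      _ < 0.0002 := by norm_num
  · calc (T * realEmb a) ^ 2 * (ρ ^ m * complexNormSq a)
        = (T * ρ ^ m) * T * (realEmb a ^ 2 * complexNormSq a) := by ring
      _ = T * (realEmb a ^ 2 * complexNormSq a) := by rw [hTρ, one_mul]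
      _ ≤ T * (realEmb a ^ 2 * (A * 19.66)) := by gcongr
      _ ≤ T * ((A * 1.0722) * (A * 19.66)) := by gcongr
      _ = T * A ^ 2 * (1.0722 * 19.66) := by ring
      _ ≤ (1 / 81) * (1.0722 * 19.66) := by gcongr
      _ ≤ 0.261 := by norm_num

/-- Legendre's theorem for a fraction not assumed to be in lowest terms. -/
lemma exists_convs_eq_div {ξ : ℝ} {p q : ℤ} (hq : q ≠ 0)
    (h : |(p : ℝ) - q * ξ| < 1 / (2 * |(q : ℝ)|)) :
    ∃ n : ℕ, (GenContFract.of ξ).convs n = (p : ℝ) / q := by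
  have hqR : 0 < |(q : ℝ)| := by positivity
  have hden : (((p / q : ℚ).den : ℕ) : ℝ) ≤ |(q : ℝ)| := by
    have hdvd : ((p / q : ℚ).den : ℤ) ∣ q := by
      rw [← Rat.divInt_eq_div]
      exact Rat.den_dvd p q
    have := Int.le_of_dvd (abs_pos.mpr hq) ((dvd_abs _ _).mpr hdvd)
    exact_mod_cast this
  have hdpos : (0 : ℝ) < ((p / q : ℚ).den : ℕ) := by exact_mod_cast (p / q : ℚ).den_pos
  obtain ⟨n, hn⟩ := Real.exists_convs_eq_rat (ξ := ξ) (q := (p / q : ℚ)) (by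
    have hqR' : (q : ℝ) ≠ 0 := by exact_mod_cast hq
    have e : ξ - ((p / q : ℚ) : ℝ) = -((p - q * ξ) / q) := by
      push_cast
      field_simp
      ring
    rw [e, abs_neg, abs_div]
    calc |(p : ℝ) - q * ξ| / |(q : ℝ)| < 1 / (2 * |(q : ℝ)|) / |(q : ℝ)| := by gcongr
      _ = 1 / (2 * |(q : ℝ)| ^ 2) := by field_simp
      _ ≤ 1 / (2 * (((p / q : ℚ).den : ℕ) : ℝ) ^ 2) := by gcongr)
  exact ⟨n, by rw [hn]; push_cast; rfl⟩

lemma eq_pow_mulVec {M : Matrix (Fin 3) (Fin 3) ℤ} {f : ℤ → (Fin 3 → ℤ)}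
    (hf : ∀ j : ℤ, f (j + 1) = M.mulVec (f j)) (n : ℕ) : f n = M ^ n *ᵥ f 0 := by
  induction n with
  | zero => simp
  | succ n ih => rw [pow_succ', ← mulVec_mulVec, ← ih]; exact_mod_cast hf n

theorem short_orthogonal_vector_gives_convergent
    (s : ℤ → (Fin 3 → ℤ))
    (hs0 : s 0 = ![0, 1, 0])
    (hs : ∀ j : ℤ, s (j + 1) = S.mulVec (s j))
    (sstar : ℤ → (Fin 3 → ℤ))
    (hsstar0 : sstar 0 = ![1, 0, 0])
    (hsstar : ∀ j : ℤ, sstar (j + 1) = Sᵀ.mulVec (sstar j))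
    (j : ℤ) (hj : 1 ≤ j)
    (a : Fin 3 → ℤ) (ha : a ≠ 0)
    (horth : a ⬝ᵥ sstar j = 0)
    (hshort : Real.sqrt ((a 0 : ℝ) ^ 2 + (a 1 : ℝ) ^ 2 + (a 2 : ℝ) ^ 2)
      < (1 / 3) * ρ ^ ((j : ℝ) / 4)) :
    ∃ p q : ℤ, q ≠ 0 ∧
      a 0 • s (j - 1) + a 1 • s j + a 2 • s (j + 1) = ![0, p, -q] ∧
      |(p : ℝ) - (q : ℝ) * σ| < 1 / (2 * |(q : ℝ)|) ∧
      ∃ n : ℕ, (GenContFract.of σ).convs n = (p : ℝ) / (q : ℝ) := by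
  obtain ⟨n, rfl⟩ : ∃ n : ℕ, j = (n : ℤ) + 1 := ⟨(j - 1).toNat, by omega⟩
  have hcomb : a 0 • s ((n : ℤ) + 1 - 1) + a 1 • s ((n : ℤ) + 1) + a 2 • s ((n : ℤ) + 1 + 1)
      = S ^ (n + 1) *ᵥ a := by
    have hbase : S *ᵥ a
        = a 0 • ![0, 1, 0] + a 1 • S *ᵥ ![0, 1, 0] + a 2 • S *ᵥ (S *ᵥ ![0, 1, 0]) := by
      simp only [S_mulVec]
      ext i
      fin_cases i <;> simp <;> ring
    have hcomm : ∀ w, S *ᵥ (S ^ n *ᵥ w) = S ^ n *ᵥ (S *ᵥ w) := fun w => by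
      rw [mulVec_mulVec, mulVec_mulVec, ← pow_succ', pow_succ]
    rw [add_sub_cancel_right, hs (n + 1), hs n, eq_pow_mulVec hs n, hs0, pow_succ, ← mulVec_mulVec, hbase]
    simp only [mulVec_add, mulVec_smul, hcomm]
  have hzero : (S ^ (n + 1) *ᵥ a) 0 = 0 := by
    have h := eq_pow_mulVec hsstar (n + 1)
    push_cast at h
    rw [h, hsstar0, ← transpose_pow, mulVec_transpose, dotProduct_comm,
      ← dotProduct_mulVec] at horth
    simpa [dotProduct, Fin.sum_univ_three] using horth
  have hne := S_pow_mulVec_ne_zero (n + 1) ha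
  obtain ⟨hβ, hprod⟩ := embedding_bounds (m := n + 1) ha (by push_cast at hshort ⊢; exact hshort)
  rw [hcomb]
  set v := S ^ (n + 1) *ᵥ a
  have hv : v = ![0, v 1, - -v 2] := by
    ext i
    fin_cases i <;> simp [hzero]
  generalize hp : v 1 = p at hv
  generalize hq : - v 2 = q at hv
  have hv2 : v 2 = -q := by omega
  have hσ := σ_gt
  have hσ' := σ_lt
  set β := (p : ℝ) - q * σ with hβdef
  have hreal : realEmb v = σ * β := by
    simp only [realEmb, hzero, hp, hv2, hβdef]
    push_cast
    ring
  have hcplx : complexNormSq v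
      = ρ * (β ^ 2 + 3 * (1 + σ) * q * β + 3 * (1 + σ) ^ 2 * q ^ 2) := by
    simp only [complexNormSq, hzero, hp, hv2, hβdef, ρ_eq]
    push_cast
    ring
  have hβ_sq : β ^ 2 < 0.003 := by
    rw [hreal, mul_pow] at hβ
    nlinarith [sq_nonneg β]
  have hq0 : q ≠ 0 := by
    rintro rfl
    have hp0 : p = 0 := by
      have h1 : ((p ^ 2 : ℤ) : ℝ) < (1 : ℤ) := by
        simp only [hβdef, Int.cast_zero, zero_mul, sub_zero] at hβ_sq
        push_cast
        linarith
      have h2 : p ^ 2 < 1 := by exact_mod_cast h1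
      exact sq_eq_zero_iff.mp (by linarith [sq_nonneg p] : p ^ 2 = 0)
    apply hne
    rw [hv, hp0]
    ext i
    fin_cases i <;> simp
  have hqR : 0 < |(q : ℝ)| := by positivity
  have happrox : |β| < 1 / (2 * |(q : ℝ)|) := by
    rw [lt_div_iff₀ (by positivity)]
    by_contra! hc
    set y := |β| * |(q : ℝ)| with hy
    have hy' : 1 / 2 ≤ y := by rw [hy]; linarith
    have hbq : -y ≤ q * β := by
      rw [hy, mul_comm |β|, ← abs_mul]
      exact neg_abs_le _
    have hysq : y ^ 2 = β ^ 2 * q ^ 2 := by rw [hy, mul_pow, sq_abs, sq_abs]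
    have h1 : σ * (β ^ 4 + 3 * (1 + σ) * (q * β) * β ^ 2 + 3 * (1 + σ) ^ 2 * y ^ 2) ≤ 0.261 := by
      rw [hreal, hcplx] at hprod
      rw [hysq]
      refine le_of_eq_of_le ?_ hprod
      linear_combination (-(σ * (β ^ 4 + 3 * (1 + σ) * (q * β) * β ^ 2
        + 3 * (1 + σ) ^ 2 * (β ^ 2 * q ^ 2)))) * σ_mul_ρ
    have h2 : 3 * (1 + σ) * (-y) * β ^ 2 ≤ 3 * (1 + σ) * (q * β) * β ^ 2 := by gcongr
    have h3 : 3 * (1 + σ) * y * β ^ 2 ≤ 3 * (1 + 0.26) * y * 0.003 := by gcongr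
    have h4 : 3 * (1 + 0.2599) ^ 2 * y ^ 2 ≤ 3 * (1 + σ) ^ 2 * y ^ 2 := by gcongr
    have h5 : 1.1 ≤ β ^ 4 + 3 * (1 + σ) * (q * β) * β ^ 2 + 3 * (1 + σ) ^ 2 * y ^ 2 := by
      have : 0 ≤ β ^ 4 := by positivity
      nlinarith
    nlinarith
  exact ⟨p, q, hq0, hv, happrox, exists_convs_eq_div hq0 happrox⟩
end
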